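/- arXiv:math/0608287 — 2 statements merged into one kernel-verified Lean document; each statement's English description precedes it below -/
import Mathlib

section
/- If a discriminant hyperplane and a chordal hyperplane meet in complex hyperbolic 10-space, then they are orthogonal: if r is a nodal root of Λ and s is a chordal root of Λ, and there exists a vector x ∈ ℂ¹¹ with ⟨x,x⟩ < 0 and ⟨x,r⟩ = ⟨x,s⟩ = 0, then ⟨r,s⟩ = 0. -/
noncomputable section

/-- The primitive cube root of unity `ω = e^{2πi/3}`. -/
def ω : ℂ := ⟨-1/2, Real.sqrt 3 / 2⟩

/-- `θ = ω - ω̄`, a square root of `-3`. -/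
def θ : ℂ := ω - (starRingEnd ℂ) ω

/-- The ring of Eisenstein integers `ℰ = ℤ[ω]` as a subring of ℂ. -/
def Eis : Subring ℂ := Subring.closure {ω}

/-- The Gram matrix of `E₈^ℰ`. -/
def Bmat : Matrix (Fin 4) (Fin 4) ℂ :=
  !![3, θ, 0, 0; -θ, 3, θ, 0; 0, -θ, 3, θ; 0, 0, -θ, 3]

/-- The Gram matrix of the hyperbolic cell `H`. -/
def Cmat : Matrix (Fin 2) (Fin 2) ℂ := !![0, θ; -θ, 0]

/-- The Gram matrix of `Λ₁₀`: block diagonal with blocks B, B, C. -/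
def Lam10 : Matrix (Fin 10) (Fin 10) ℂ := Matrix.of fun i j =>
  if h : i.val < 4 ∧ j.val < 4 then Bmat ⟨i.val, h.1⟩ ⟨j.val, h.2⟩
  else if h : 4 ≤ i.val ∧ i.val < 8 ∧ 4 ≤ j.val ∧ j.val < 8 then
    Bmat ⟨i.val - 4, by omega⟩ ⟨j.val - 4, by omega⟩
  else if h : 8 ≤ i.val ∧ 8 ≤ j.val then
    Cmat ⟨i.val - 8, by have := i.isLt; omega⟩ ⟨j.val - 8, by have := j.isLt; omega⟩
  else 0

/-- The Gram matrix of `Λ = (3) ⊕ Λ₁₀`: block diagonal with blocks (3), B, B, C. -/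
def Lam11 : Matrix (Fin 11) (Fin 11) ℂ := Matrix.of fun i j =>
  if i.val = 0 ∧ j.val = 0 then 3
  else if h : 1 ≤ i.val ∧ 1 ≤ j.val then
    Lam10 ⟨i.val - 1, by have := i.isLt; omega⟩ ⟨j.val - 1, by have := j.isLt; omega⟩
  else 0

/-- The Hermitian form of `Λ`, on vectors with complex entries. -/
def herm11C (x y : Fin 11 → ℂ) : ℂ :=
  ∑ i : Fin 11, ∑ j : Fin 11, Lam11 i j * x i * (starRingEnd ℂ) (y j)

/-- The ideal `θℰ ⊆ ℂ`. -/
def thetaEis : Set ℂ := {z | ∃ e : Eis, z = θ * (e : ℂ)}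

/-- The ideal `3ℰ ⊆ ℂ`. -/
def threeEis : Set ℂ := {z | ∃ e : Eis, z = 3 * (e : ℂ)}

/-- The set `{⟨r,x⟩ : x ∈ Λ}` of inner products of `r` with lattice vectors. -/
def innerSet (r : Fin 11 → ℂ) : Set ℂ :=
  {c | ∃ x : Fin 11 → ℂ, (∀ i, x i ∈ Eis) ∧ c = herm11C r x}

lemma conj_θ : (starRingEnd ℂ) θ = -θ := by simp [θ]

lemma θ_mul_self : θ * θ = -3 := by
  have h : Real.sqrt 3 * Real.sqrt 3 = 3 := Real.mul_self_sqrt (by norm_num)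
  apply Complex.ext
  · simp only [θ, ω, Complex.mul_re, Complex.sub_re, Complex.sub_im, Complex.conj_re,
      Complex.conj_im, Complex.neg_re, Complex.re_ofNat]
    linear_combination -h
  · simp [θ, ω]

lemma exists_int_of_mem_Eis {e : ℂ} (he : e ∈ Eis) : ∃ a b : ℤ, e = a + b * ω := by
  have hω : ω * ω = -1 - ω := by
    have h : Real.sqrt 3 * Real.sqrt 3 = 3 := Real.mul_self_sqrt (by norm_num)
    apply Complex.ext
    · simp only [ω, Complex.mul_re, Complex.sub_re, Complex.neg_re, Complex.one_re]
      linear_combination (-1 / 4) * h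
    · simp only [ω, Complex.mul_im, Complex.sub_im, Complex.neg_im, Complex.one_im]
      ring
  induction he using Subring.closure_induction with
  | mem x hx => exact ⟨0, 1, by simpa using hx⟩
  | zero => exact ⟨0, 0, by simp⟩
  | one => exact ⟨1, 0, by simp⟩
  | add x y _ _ hx hy =>
    obtain ⟨a, b, rfl⟩ := hx
    obtain ⟨c, d, rfl⟩ := hy
    exact ⟨a + c, b + d, by push_cast; ring⟩
  | neg x _ hx =>
    obtain ⟨a, b, rfl⟩ := hx
    exact ⟨-a, -b, by push_cast; ring⟩
  | mul x y _ _ hx hy =>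
    obtain ⟨a, b, rfl⟩ := hx
    obtain ⟨c, d, rfl⟩ := hy
    exact ⟨a * c - b * d, a * d + b * c - b * d, by
      push_cast; linear_combination (b * d : ℂ) * hω⟩

/-- A nonzero Eisenstein integer has norm at least one. -/
lemma one_le_normSq_of_mem_Eis {e : ℂ} (he : e ∈ Eis) (h0 : e ≠ 0) : 1 ≤ Complex.normSq e := by
  obtain ⟨a, b, hab⟩ := exists_int_of_mem_Eis he
  have h : Real.sqrt 3 * Real.sqrt 3 = 3 := Real.mul_self_sqrt (by norm_num)
  have key : Complex.normSq e = ((a * a - a * b + b * b : ℤ) : ℝ) := by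
    rw [hab, Complex.normSq_apply]
    simp [ω]
    linear_combination (b * b / 4 : ℝ) * h
  have hpos : 0 < Complex.normSq e := Complex.normSq_pos.2 h0
  rw [key] at hpos ⊢
  exact_mod_cast hpos

lemma herm11C_smul_left (c : ℂ) (x y : Fin 11 → ℂ) : herm11C (c • x) y = c * herm11C x y := by
  simp only [herm11C, Finset.mul_sum, Pi.smul_apply, smul_eq_mul]
  exact Finset.sum_congr rfl fun i _ => Finset.sum_congr rfl fun j _ => by ring

lemma herm11C_sub_left (x y z : Fin 11 → ℂ) :
    herm11C (x - y) z = herm11C x z - herm11C y z := by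
  simp only [herm11C, ← Finset.sum_sub_distrib, Pi.sub_apply]
  exact Finset.sum_congr rfl fun i _ => Finset.sum_congr rfl fun j _ => by ring

/-- The sesquilinear form with Gram matrix `Bmat`. -/
def hermB (a b c d a' b' c' d' : ℂ) : ℂ :=
  a * (3 * a' + θ * b') + b * (-θ * a' + 3 * b' + θ * c') +
    c * (-θ * b' + 3 * c' + θ * d') + d * (-θ * c' + 3 * d')

lemma herm11C_eq (x y : Fin 11 → ℂ) : herm11C x y =
    3 * x 0 * (starRingEnd ℂ) (y 0) +
    hermB (x 1) (x 2) (x 3) (x 4) ((starRingEnd ℂ) (y 1)) ((starRingEnd ℂ) (y 2))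
      ((starRingEnd ℂ) (y 3)) ((starRingEnd ℂ) (y 4)) +
    hermB (x 5) (x 6) (x 7) (x 8) ((starRingEnd ℂ) (y 5)) ((starRingEnd ℂ) (y 6))
      ((starRingEnd ℂ) (y 7)) ((starRingEnd ℂ) (y 8)) +
    θ * (x 9 * (starRingEnd ℂ) (y 10) - x 10 * (starRingEnd ℂ) (y 9)) := by
  simp [herm11C, Fin.sum_univ_succ, Lam11, Lam10, Bmat, Cmat, hermB]
  ring

lemma conj_herm11C (x y : Fin 11 → ℂ) : (starRingEnd ℂ) (herm11C x y) = herm11C y x := by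
  simp only [herm11C_eq, hermB, map_add, map_mul, map_sub, map_neg, map_ofNat, conj_θ,
    Complex.conj_conj]
  ring

lemma herm11C_smul_right (c : ℂ) (x y : Fin 11 → ℂ) :
    herm11C x (c • y) = (starRingEnd ℂ) c * herm11C x y := by
  rw [← conj_herm11C, herm11C_smul_left, map_mul, conj_herm11C]

lemma herm11C_sub_right (x y z : Fin 11 → ℂ) :
    herm11C x (y - z) = herm11C x y - herm11C x z := by
  rw [← conj_herm11C, herm11C_sub_left, map_sub, conj_herm11C, conj_herm11C]

/-- The norm form of `Bmat` as a sum of squares. -/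
lemma hermB_self (a b c d : ℂ) :
    hermB a b c d ((starRingEnd ℂ) a) ((starRingEnd ℂ) b) ((starRingEnd ℂ) c)
      ((starRingEnd ℂ) d) =
    ((3 * Complex.normSq (a - θ / 3 * b) + 2 * Complex.normSq (b - θ / 2 * c) +
      3 / 2 * Complex.normSq (c - 2 * θ / 3 * d) + Complex.normSq d : ℝ) : ℂ) := by
  push_cast
  simp only [← Complex.mul_conj, map_sub, map_mul, map_div₀, map_ofNat, conj_θ, hermB]
  linear_combination (b * (starRingEnd ℂ) b / 3 + c * (starRingEnd ℂ) c / 2 +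
    2 / 3 * (d * (starRingEnd ℂ) d)) * θ_mul_self

/-- The form `Λ` as a signed sum of squares, with a single negative square. -/
lemma herm11C_self_re (y : Fin 11 → ℂ) : (herm11C y y).re =
    3 * Complex.normSq (y 0) +
    (3 * Complex.normSq (y 1 - θ / 3 * y 2) + 2 * Complex.normSq (y 2 - θ / 2 * y 3) +
      3 / 2 * Complex.normSq (y 3 - 2 * θ / 3 * y 4) + Complex.normSq (y 4)) +
    (3 * Complex.normSq (y 5 - θ / 3 * y 6) + 2 * Complex.normSq (y 6 - θ / 2 * y 7) +
      3 / 2 * Complex.normSq (y 7 - 2 * θ / 3 * y 8) + Complex.normSq (y 8)) +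
    1 / 2 * Complex.normSq (y 9 - θ * y 10) - 1 / 2 * Complex.normSq (y 9 + θ * y 10) := by
  rw [← Complex.ofReal_re (_ - _)]
  congr 1
  rw [herm11C_eq, hermB_self, hermB_self]
  push_cast
  simp only [← Complex.mul_conj, map_sub, map_add, map_mul, conj_θ]
  ring

lemma herm11C_self_re_nonneg {y : Fin 11 → ℂ} (hn : y 9 + θ * y 10 = 0) :
    0 ≤ (herm11C y y).re := by
  rw [herm11C_self_re, hn, map_zero, mul_zero, sub_zero]
  simp only [Complex.normSq_eq_norm_sq]
  positivity

lemma eq_zero_of_herm11C_self_re_nonpos {y : Fin 11 → ℂ} (hn : y 9 + θ * y 10 = 0)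
    (hy : (herm11C y y).re ≤ 0) : y = 0 := by
  rw [herm11C_self_re, hn, map_zero, mul_zero, sub_zero] at hy
  have p := Complex.normSq_nonneg
  have p0 := p (y 0)
  have p1 := p (y 1 - θ / 3 * y 2)
  have p2 := p (y 2 - θ / 2 * y 3)
  have p3 := p (y 3 - 2 * θ / 3 * y 4)
  have p4 := p (y 4)
  have p5 := p (y 5 - θ / 3 * y 6)
  have p6 := p (y 6 - θ / 2 * y 7)
  have p7 := p (y 7 - 2 * θ / 3 * y 8)
  have p8 := p (y 8)
  have p9 := p (y 9 - θ * y 10)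
  have h0 : y 0 = 0 := Complex.normSq_eq_zero.1 (by linarith)
  have h4 : y 4 = 0 := Complex.normSq_eq_zero.1 (by linarith)
  have h3 : y 3 - 2 * θ / 3 * y 4 = 0 := Complex.normSq_eq_zero.1 (by linarith)
  have h2 : y 2 - θ / 2 * y 3 = 0 := Complex.normSq_eq_zero.1 (by linarith)
  have h1 : y 1 - θ / 3 * y 2 = 0 := Complex.normSq_eq_zero.1 (by linarith)
  have h8 : y 8 = 0 := Complex.normSq_eq_zero.1 (by linarith)
  have h7 : y 7 - 2 * θ / 3 * y 8 = 0 := Complex.normSq_eq_zero.1 (by linarith)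
  have h6 : y 6 - θ / 2 * y 7 = 0 := Complex.normSq_eq_zero.1 (by linarith)
  have h5 : y 5 - θ / 3 * y 6 = 0 := Complex.normSq_eq_zero.1 (by linarith)
  have hm : y 9 - θ * y 10 = 0 := Complex.normSq_eq_zero.1 (by linarith)
  have h9 : y 9 = 0 := by linear_combination (hn + hm) / 2
  have h10 : y 10 = 0 := by
    linear_combination (-θ / 6) * (hn - hm) + (y 10 / 3) * θ_mul_self
  simp only [h4, mul_zero, sub_zero] at h3
  simp only [h3, mul_zero, sub_zero] at h2
  simp only [h2, mul_zero, sub_zero] at h1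
  simp only [h8, mul_zero, sub_zero] at h7
  simp only [h7, mul_zero, sub_zero] at h6
  simp only [h6, mul_zero, sub_zero] at h5
  ext i
  fin_cases i <;> assumption

/-- The orthogonal complement of a negative vector is positive definite. -/
lemma eq_zero_of_orthogonal_negative {x y : Fin 11 → ℂ} (hx : (herm11C x x).re < 0)
    (hxy : herm11C x y = 0) (hy : (herm11C y y).re ≤ 0) : y = 0 := by
  refine eq_zero_of_herm11C_self_re_nonpos ?_ hy
  set m := y 9 + θ * y 10 with hm
  set n := x 9 + θ * x 10 with hn
  have hyx : herm11C y x = 0 := by rw [← conj_herm11C, hxy, map_zero]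
  have hz : 0 ≤ (herm11C (m • x - n • y) (m • x - n • y)).re := by
    apply herm11C_self_re_nonneg
    simp only [Pi.sub_apply, Pi.smul_apply, smul_eq_mul, hm, hn]
    ring
  have e : herm11C (m • x - n • y) (m • x - n • y) =
      (Complex.normSq m : ℂ) * herm11C x x + (Complex.normSq n : ℂ) * herm11C y y := by
    simp only [herm11C_sub_left, herm11C_sub_right, herm11C_smul_left, herm11C_smul_right,
      hxy, hyx, ← Complex.mul_conj]
    ring
  rw [e, Complex.add_re, Complex.re_ofReal_mul, Complex.re_ofReal_mul] at hz
  by_contra h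
  have h1 := mul_neg_of_pos_of_neg (Complex.normSq_pos.2 h) hx
  have h2 := mul_nonpos_of_nonneg_of_nonpos (Complex.normSq_nonneg n) hy
  linarith

/-- If a discriminant hyperplane and a chordal hyperplane meet in complex
hyperbolic 10-space then they are orthogonal: if `r` is a nodal root, `s` a chordal
root, and some `x ∈ ℂ¹¹` of negative norm is orthogonal to both, then `⟨r,s⟩ = 0`. -/
theorem stmt_14 :
    ∀ r s : Fin 11 → ℂ,
      (∀ i, r i ∈ Eis) → (∀ i, s i ∈ Eis) →
      herm11C r r = 3 → herm11C s s = 3 →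
      innerSet r = thetaEis → innerSet s = threeEis →
      (∃ x : Fin 11 → ℂ, (herm11C x x).re < 0 ∧ herm11C x r = 0 ∧ herm11C x s = 0) →
      herm11C r s = 0 := by
  rintro r s hr - hrr hss hrS hsS ⟨x, hx, hxr, hxs⟩
  obtain ⟨f, hf⟩ : herm11C s r ∈ threeEis := hsS ▸ ⟨r, hr, rfl⟩
  set e : ℂ := (starRingEnd ℂ) f with he
  have hrs : herm11C r s = 3 * e := by rw [← conj_herm11C, hf, map_mul, map_ofNat]
  by_contra h0
  have hf0 : (f : ℂ) ≠ 0 := by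
    intro h
    rw [hrs, he, h, map_zero, mul_zero] at h0
    exact h0 rfl
  have hef : Complex.normSq e = Complex.normSq f := Complex.normSq_conj _
  have he1 : 1 ≤ Complex.normSq e := hef ▸ one_le_normSq_of_mem_Eis f.2 hf0
  have hres : r - e • s = 0 := by
    refine eq_zero_of_orthogonal_negative hx ?_ ?_
    · rw [herm11C_sub_right, herm11C_smul_right, hxr, hxs, mul_zero, sub_zero]
    · have : herm11C (r - e • s) (r - e • s) = ((3 - 3 * Complex.normSq e : ℝ) : ℂ) := by
        have hfe : (f : ℂ) = (starRingEnd ℂ) e := by rw [he, Complex.conj_conj]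
        push_cast
        simp only [herm11C_sub_left, herm11C_sub_right, herm11C_smul_left, herm11C_smul_right,
          hrr, hss, hf, hrs, hfe, ← Complex.mul_conj]
        ring
      rw [this, Complex.ofReal_re]
      linarith
  obtain ⟨y, hy, hθy⟩ : θ ∈ innerSet r := hrS ▸ ⟨1, by simp⟩
  obtain ⟨g, hg⟩ : herm11C s y ∈ threeEis := hsS ▸ ⟨y, hy, rfl⟩
  have hθ : θ = e * (3 * g) := by
    rw [← hg, ← herm11C_smul_left, ← sub_eq_zero.1 hres, hθy]
  have h9 : (-3 : ℂ) = 9 * (e * g) * (e * g) := by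
    rw [← θ_mul_self, hθ]; ring
  have hg0 : (g : ℂ) ≠ 0 := by
    intro h
    rw [h] at h9
    norm_num at h9
  have hg1 := one_le_normSq_of_mem_Eis g.2 hg0
  have hN := congrArg Complex.normSq h9
  simp only [map_mul, Complex.normSq_neg, Complex.normSq_ofNat] at hN
  have := one_le_mul_of_one_le_of_one_le he1 hg1
  nlinarith
end
end

section
/- For every integer n ≥ 12, let b be the symmetric bilinear form on ℤ^{2n} with basis a₁, …, aₙ, b₁, …, bₙ determined by: b(aᵢ,aᵢ) = b(bᵢ,bᵢ) = 2 for all i; b(aᵢ,a_{i+1}) = −1 and b(bᵢ,b_{i+1}) = −1 for 1 ≤ i ≤ n−1; b(aᵢ,bᵢ) = −1 for all i; b(aᵢ,b_{i−1}) = 1 for 2 ≤ i ≤ n; and b vanishes on all other pairs of distinct basis vectors. Then the ℝ-bilinear extension of b to ℝ^{2n} admits a subspace of dimension at least 4 on which b is negative definite. -/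
noncomputable section

/-- The Gram matrix of the vanishing lattice of an `Aₙ` singularity of a cubic
threefold, on the basis `a₁, …, aₙ, b₁, …, bₙ` (indexed by `Fin n ⊕ Fin n`):
`aᵢ² = bᵢ² = 2`, `aᵢ·a_{i±1} = bᵢ·b_{i±1} = −1`, `aᵢ·bᵢ = −1`, `aᵢ·b_{i−1} = 1`, and
all other pairs of distinct basis vectors pair to 0. -/
def gA (n : ℕ) : (Fin n ⊕ Fin n) → (Fin n ⊕ Fin n) → ℝ
  | Sum.inl i, Sum.inl j =>
      if i = j then 2 else if i.val + 1 = j.val ∨ j.val + 1 = i.val then -1 else 0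
  | Sum.inr i, Sum.inr j =>
      if i = j then 2 else if i.val + 1 = j.val ∨ j.val + 1 = i.val then -1 else 0
  | Sum.inl i, Sum.inr j =>
      if i = j then -1 else if i.val = j.val + 1 then 1 else 0
  | Sum.inr i, Sum.inl j =>
      if i = j then -1 else if j.val = i.val + 1 then 1 else 0

/-- The ℝ-bilinear extension of the above symmetric bilinear form to `ℝ^{2n}`. -/
def bForm (n : ℕ) (x y : (Fin n ⊕ Fin n) → ℝ) : ℝ :=
  ∑ k : Fin n ⊕ Fin n, ∑ l : Fin n ⊕ Fin n, gA n k l * x k * y l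

/-- The inclusion of the first `m` vectors of each of the two halves of the basis. -/
def basisInclusion {m n : ℕ} (h : m ≤ n) : Fin m ⊕ Fin m → Fin n ⊕ Fin n :=
  Sum.map (Fin.castLE h) (Fin.castLE h)

theorem basisInclusion_injective {m n : ℕ} (h : m ≤ n) :
    Function.Injective (basisInclusion h) :=
  (Fin.castLE_injective h).sumMap (Fin.castLE_injective h)

theorem gA_basisInclusion {m n : ℕ} (h : m ≤ n) (k l : Fin m ⊕ Fin m) :
    gA n (basisInclusion h k) (basisInclusion h l) = gA m k l := by
  rcases k with i | i <;> rcases l with j | j <;> simp [gA, basisInclusion]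

theorem sum_mul_extend_zero {ι κ R : Type*} [Fintype ι] [Fintype κ] [Semiring R] {e : ι → κ}
    (he : Function.Injective e) (f : κ → R) (x : ι → R) :
    ∑ k, f k * Function.extend e x 0 k = ∑ i, f (e i) * x i := by
  classical
  rw [← Finset.sum_subset (Finset.subset_univ (Finset.univ.image e)),
    Finset.sum_image he.injOn]
  · simp [he.extend_apply]
  · intro k _ hk
    rw [Function.extend_apply']
    · simp
    · simpa using hk

/-- Extension by zero along the inclusion of bases is isometric. -/
theorem bForm_extend_zero {m n : ℕ} (h : m ≤ n) (x y : Fin m ⊕ Fin m → ℝ) :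
    bForm n (Function.extend (basisInclusion h) x 0) (Function.extend (basisInclusion h) y 0) =
      bForm m x y := by
  have he := basisInclusion_injective h
  unfold bForm
  simp_rw [sum_mul_extend_zero he, mul_right_comm _ _ (y _), ← Finset.sum_mul]
  rw [sum_mul_extend_zero he]
  simp_rw [gA_basisInclusion]

/-- Four vectors of the lattice with `n = 12` that span a copy of `A₂(-1) ⊕ A₂(-1)`,
as the columns of a matrix. -/
def negativeVectors : Matrix (Fin 12 ⊕ Fin 12) (Fin 4) ℝ :=
  Matrix.of (Sum.elim
    ![![1, 0, 1, 0], ![2, -1, 2, -1], ![2, -2, 2, -2], ![1, -2, 1, -2],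
      ![0, -2, 0, -1], ![-1, -1, 0, 0], ![-1, 0, 1, 0], ![0, 0, 2, -1],
      ![0, 0, 3, -3], ![0, 0, 2, -4], ![0, 0, 0, -3], ![0, 0, -1, -1]]
    ![![0, 1, 0, 1], ![1, 1, 1, 1], ![2, 0, 2, 0], ![2, -1, 2, -1],
      ![2, -2, 1, -1], ![1, -2, 0, 0], ![0, -1, 0, 1], ![0, 0, 1, 1],
      ![0, 0, 3, 0], ![0, 0, 4, -2], ![0, 0, 3, -3], ![0, 0, 1, -2]])

theorem bForm_negativeVectors_mulVec (c : Fin 4 → ℝ) :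
    bForm 12 (negativeVectors.mulVec c) (negativeVectors.mulVec c) =
      -2 * (c 0 ^ 2 - c 0 * c 1 + c 1 ^ 2 + (c 2 ^ 2 - c 2 * c 3 + c 3 ^ 2)) := by
  have expand (a b : Fin 12 → ℝ) : bForm 12 (Sum.elim a b) (Sum.elim a b) =
      2 * ((∑ i, (a i ^ 2 + b i ^ 2 - a i * b i)) +
        ∑ i : Fin 11, (a i.succ * b i.castSucc - a i.castSucc * a i.succ
          - b i.castSucc * b i.succ)) := by
    simp [bForm, gA, Fin.sum_univ_succ]
    ring
  rw [← Sum.elim_comp_inl_inr (negativeVectors.mulVec c), expand]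
  simp [negativeVectors, Matrix.mulVec, dotProduct, Fin.sum_univ_succ]
  ring

theorem bForm_negativeVectors_mulVec_neg {c : Fin 4 → ℝ} (hc : c ≠ 0) :
    bForm 12 (negativeVectors.mulVec c) (negativeVectors.mulVec c) < 0 := by
  rw [bForm_negativeVectors_mulVec]
  by_contra! h
  refine hc (funext fun i => pow_eq_zero_iff two_ne_zero |>.mp ?_)
  have h01 := sq_nonneg (c 0 - c 1)
  have h23 := sq_nonneg (c 2 - c 3)
  fin_cases i <;> simp <;>
    nlinarith [sq_nonneg (c 0), sq_nonneg (c 1), sq_nonneg (c 2), sq_nonneg (c 3)]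

/-- For every `n ≥ 12`, the real extension of this bilinear form admits a
subspace of dimension at least 4 on which it is negative definite. -/
theorem stmt_19 :
    ∀ n : ℕ, 12 ≤ n →
      ∃ W : Submodule ℝ ((Fin n ⊕ Fin n) → ℝ),
        4 ≤ Module.finrank ℝ W ∧ ∀ v ∈ W, v ≠ 0 → bForm n v v < 0 := by
  intro n hn
  let T : (Fin 4 → ℝ) →ₗ[ℝ] (Fin n ⊕ Fin n → ℝ) :=
    Function.ExtendByZero.linearMap ℝ (basisInclusion hn) ∘ₗ negativeVectors.mulVecLin
  have hT (c : Fin 4 → ℝ) (hc : c ≠ 0) : bForm n (T c) (T c) < 0 :=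
    (bForm_extend_zero hn _ _).trans_lt (bForm_negativeVectors_mulVec_neg hc)
  have hinj : Function.Injective T := by
    rw [injective_iff_map_eq_zero]
    intro c h
    by_contra hc
    simpa [h, bForm] using hT c hc
  refine ⟨LinearMap.range T, ?_, ?_⟩
  · rw [LinearMap.finrank_range_of_inj hinj]
    simp
  · rintro _ ⟨c, rfl⟩ hv
    exact hT c fun hc => hv (by rw [hc, map_zero])
end
end
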